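/- arXiv:2009.03794 — 4 statements merged into one kernel-verified Lean document; each statement's English description precedes it below -/
import Mathlib

section
/- Let n ≥ 2, s ∈ (0,1), and let K : ℝⁿ → [0,∞) be measurable with 0 ≤ K(x) ≤ |x|^{−(n+s)} for all x ≠ 0. Then for every set E ⊆ ℝⁿ of finite perimeter and finite Lebesgue measure, P_K(E) ≤ P_s(E) ≤ (2^{1−s} n ω_n / (s(1−s))) · P(E)^s · |E|^{1−s}, where ω_n is the Lebesgue measure of the unit ball of ℝⁿ. -/
open MeasureTheory Metric Set Filter
open scoped ENNReal Pointwise symmDiff Classical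

noncomputable section

abbrev Euc (n : ℕ) := EuclideanSpace ℝ (Fin n)

/-- Divergence of a vector field on ℝⁿ. -/
def divg {n : ℕ} (g : Euc n → Euc n) (x : Euc n) : ℝ :=
  ∑ i : Fin n, fderiv ℝ g x (EuclideanSpace.single i 1) i

/-- The admissible values in the variational definition of the perimeter:
values `∫_E div g` over C¹ compactly supported vector fields with `‖g‖ ≤ 1`. -/
def perimVals {n : ℕ} (E : Set (Euc n)) : Set ℝ :=
  {r | ∃ g : Euc n → Euc n, ContDiff ℝ 1 g ∧ HasCompactSupport g ∧
        (∀ x, ‖g x‖ ≤ 1) ∧ r = ∫ x in E, divg g x}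

/-- Perimeter: total variation of the characteristic function. -/
def perim {n : ℕ} (E : Set (Euc n)) : ℝ := sSup (perimVals E)

/-- A set has finite perimeter if the variational quantities are bounded above. -/
def HasFinitePerim {n : ℕ} (E : Set (Euc n)) : Prop := BddAbove (perimVals E)

/-- Characteristic function of a set. -/
def chi {n : ℕ} (E : Set (Euc n)) : Euc n → ℝ := E.indicator 1

/-- Nonlocal perimeter associated with a kernel `K`. -/
def PK {n : ℕ} (K : Euc n → ℝ) (E : Set (Euc n)) : ℝ :=
  ∫ x, ∫ y, K (x - y) * |chi E x - chi E y|

/-- Fractional `s`-perimeter. -/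
def Ps (n : ℕ) (s : ℝ) (E : Set (Euc n)) : ℝ :=
  ∫ x : Euc n, ∫ y : Euc n, |chi E x - chi E y| / ‖x - y‖ ^ ((n : ℝ) + s)

/-- The energy `J_α(E) = P(E) - α s (1-s) P_K(E)`. -/
def Jen {n : ℕ} (K : Euc n → ℝ) (s α : ℝ) (E : Set (Euc n)) : ℝ :=
  perim E - α * s * (1 - s) * PK K E

/-- The energy `F_{s,α}(E) = P(E) - α s (1-s) P_s(E)`. -/
def Fen (n : ℕ) (s α : ℝ) (E : Set (Euc n)) : ℝ :=
  perim E - α * s * (1 - s) * Ps n s E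

/-- ω_n : volume of the unit ball of ℝⁿ. -/
def ballVol (n : ℕ) : ℝ := (volume (ball (0 : Euc n) 1)).toReal

/-- Volume-constrained global minimizer of `J_α` (volume `m`). -/
def IsJMin {n : ℕ} (K : Euc n → ℝ) (s α m : ℝ) (E : Set (Euc n)) : Prop :=
  MeasurableSet E ∧ HasFinitePerim E ∧ volume E = ENNReal.ofReal m ∧
    ∀ F : Set (Euc n), MeasurableSet F → HasFinitePerim F →
      volume F = ENNReal.ofReal m → Jen K s α E ≤ Jen K s α F

/-- Volume-constrained global minimizer of `F_{s,α}` (volume `m`). -/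
def IsFMin (n : ℕ) (s α m : ℝ) (E : Set (Euc n)) : Prop :=
  MeasurableSet E ∧ HasFinitePerim E ∧ volume E = ENNReal.ofReal m ∧
    ∀ F : Set (Euc n), MeasurableSet F → HasFinitePerim F →
      volume F = ENNReal.ofReal m → Fen n s α E ≤ Fen n s α F

lemma divg_smul {n : ℕ} (ψ : Euc n → ℝ) (h : Euc n) (x : Euc n) (hψ : DifferentiableAt ℝ ψ x) :
    divg (fun y => ψ y • h) x = fderiv ℝ ψ x h := by
  have h1 : fderiv ℝ (fun y => ψ y • h) x = (fderiv ℝ ψ x).smulRight h :=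
    (hψ.hasFDerivAt.smul_const h).fderiv
  unfold divg
  rw [h1]
  have h2 : h = ∑ i : Fin n, h i • EuclideanSpace.single i (1 : ℝ) := by
    ext j
    simp [Finset.sum_apply, Pi.single_apply]
  conv_rhs => rw [h2, map_sum]
  refine Finset.sum_congr rfl fun i _ => ?_
  simp [mul_comm]

lemma perim_nonneg {n : ℕ} {E : Set (Euc n)} (hE : HasFinitePerim E) : 0 ≤ perim E := by
  refine le_csSup hE ⟨0, contDiff_const, HasCompactSupport.zero, by simp, ?_⟩
  simp [divg]

lemma int_fderiv_le {n : ℕ} {E : Set (Euc n)} (hE : HasFinitePerim E)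
    (φ : Euc n → ℝ) (hφ : ContDiff ℝ 1 φ) (hc : HasCompactSupport φ) {M : ℝ} (hM : 0 < M)
    (hφM : ∀ x, |φ x| ≤ M) (h : Euc n) (hh : h ≠ 0) :
    ∫ x in E, fderiv ℝ φ x h ≤ M * ‖h‖ * perim E := by
  have hpos : 0 < M * ‖h‖ := mul_pos hM (norm_pos_iff.2 hh)
  have key : (M * ‖h‖)⁻¹ * ∫ x in E, fderiv ℝ φ x h ≤ perim E := by
    refine le_csSup hE ⟨fun y => φ y • ((M * ‖h‖)⁻¹ • h), ?_, ?_, ?_, ?_⟩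
    · exact hφ.smul contDiff_const
    · exact hc.smul_right
    · intro x
      rw [norm_smul, norm_smul, norm_inv, Real.norm_of_nonneg hpos.le, Real.norm_eq_abs]
      have h1 : (M * ‖h‖)⁻¹ * ‖h‖ = M⁻¹ := by
        have := norm_pos_iff.2 hh
        field_simp
      rw [h1, ← div_eq_mul_inv, div_le_one hM]
      exact hφM x
    · rw [← integral_const_mul]
      refine integral_congr_ae (Eventually.of_forall fun x => ?_)
      simp only
      rw [divg_smul _ _ _ (hφ.differentiable (by norm_num) x)]
      simp
  rw [inv_mul_le_iff₀ hpos] at key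
  exact key

lemma int_shift_le {n : ℕ} {E : Set (Euc n)} (hE : HasFinitePerim E) (hV : volume E ≠ ∞)
    (φ : Euc n → ℝ) (hφ : ContDiff ℝ 1 φ) (hc : HasCompactSupport φ) {M : ℝ} (hM : 0 < M)
    (hφM : ∀ x, |φ x| ≤ M) (h : Euc n) (hh : h ≠ 0) :
    (∫ x in E, φ (x + h)) - ∫ x in E, φ x ≤ M * ‖h‖ * perim E := by
  have hfin : IsFiniteMeasure (volume.restrict E) := ⟨by simpa using lt_top_iff_ne_top.2 hV⟩
  have hcont : Continuous (fderiv ℝ φ) := hφ.continuous_fderiv (by norm_num)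
  obtain ⟨C, hC⟩ := (hc.fderiv (𝕜 := ℝ)).exists_bound_of_continuous hcont
  have hd : ∀ t : ℝ, HasDerivAt (fun t : ℝ => ∫ x in E, φ (x + t • h))
      (∫ x in E, fderiv ℝ φ (x + t • h) h) t := by
    intro t
    refine (hasDerivAt_integral_of_dominated_loc_of_deriv_le (s := univ)
      (F := fun (t : ℝ) x => φ (x + t • h)) (F' := fun (t : ℝ) x => fderiv ℝ φ (x + t • h) h)
      (bound := fun _ => C * ‖h‖) univ_mem ?_ ?_ ?_ ?_ (integrable_const _) ?_).2
    · refine Eventually.of_forall fun t => ?_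
      exact (hφ.continuous.comp (by fun_prop)).aestronglyMeasurable
    · refine Integrable.of_bound (C := M) ?_ (Eventually.of_forall fun x => hφM _)
      exact (hφ.continuous.comp (by fun_prop)).aestronglyMeasurable
    · refine Continuous.aestronglyMeasurable ?_
      exact (hcont.comp (by fun_prop)).clm_apply continuous_const
    · refine Eventually.of_forall fun x t _ => ?_
      exact ((fderiv ℝ φ (x + t • h)).le_opNorm h).trans (by gcongr; exact hC _)
    · refine Eventually.of_forall fun x t _ => ?_
      have h1 : HasDerivAt (fun t : ℝ => x + t • h) h t := by
        simpa using ((hasDerivAt_id t).smul_const h).const_add x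
      exact ((hφ.differentiable (by norm_num) _).hasFDerivAt).comp_hasDerivAt t h1
  have hb : ∀ t : ℝ, deriv (fun t : ℝ => ∫ x in E, φ (x + t • h)) t ≤ M * ‖h‖ * perim E := by
    intro t
    rw [(hd t).deriv]
    have := int_fderiv_le hE (fun x => φ (x + t • h)) (hφ.comp (by fun_prop))
      (hc.comp_homeomorph (Homeomorph.addRight (t • h))) hM (fun x => hφM _) h hh
    simpa only [fderiv_comp_add_right] using this
  have := image_sub_le_mul_sub_of_deriv_le (fun t => (hd t).differentiableAt) hb zero_le_one
  simpa using this

lemma int_abs_le {n : ℕ} {E : Set (Euc n)} (hEm : MeasurableSet E)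
    (hE : HasFinitePerim E) (hV : volume E ≠ ∞) (h : Euc n) :
    ∫ x, |chi E (x - h) - chi E x| ≤ ‖h‖ * perim E := by
  rcases eq_or_ne h 0 with rfl | hh
  · simp
  have hi : Integrable (chi E) := (integrable_indicator_iff hEm).2
    (integrableOn_const hV)
  have hi' : Integrable (fun x => chi E (x - h)) := hi.comp_sub_right h
  set f : Euc n → ℝ := fun x => chi E (x - h) - chi E x with hf
  have hfi : Integrable f := hi'.sub hi
  have hf1 : ∀ x, f x = 0 ∨ f x = 1 ∨ f x = -1 := by
    intro x
    simp only [hf, chi, indicator]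
    split_ifs <;> simp
  have habs : ∀ x, |f x| ≤ 1 := by
    intro x; rcases hf1 x with h | h | h <;> simp [h]
  have hP := perim_nonneg hE
  have key : ∀ ε : ℝ, 0 < ε → (1 - ε) * (∫ x, |f x|) - ε ≤ (1 + ε) * ‖h‖ * perim E := by
    intro ε hε
    obtain ⟨g, gc, gε, gcont, gi⟩ := hfi.exists_hasCompactSupport_integral_sub_le hε
    set g' : Euc n → ℝ := fun x => max (-1) (min 1 (g x)) with hg'
    have g'cont : Continuous g' := by fun_prop
    have g'c : HasCompactSupport g' := by
      refine gc.comp_left (g := fun y : ℝ => max (-1) (min 1 y)) ?_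
      simp
    obtain ⟨φ, φd, φε, φs⟩ := g'cont.exists_contDiff_approx 1 (ε := fun _ => ε)
      continuous_const (fun _ => hε)
    have φc : HasCompactSupport φ := g'c.mono φs
    have g'1 : ∀ x, |g' x| ≤ 1 := by
      intro x
      rw [abs_le]
      exact ⟨le_max_left _ _, max_le (by norm_num) (min_le_left _ _)⟩
    have φ1 : ∀ x, |φ x| ≤ 1 + ε := by
      intro x
      have h1 := φε x
      rw [Real.dist_eq] at h1
      have h2 := g'1 x
      have h3 := abs_sub_abs_le_abs_sub (φ x) (g' x)
      linarith
    have hmain := int_shift_le hE hV φ φd φc (by linarith : 0 < 1 + ε) φ1 h hh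
    have φi : Integrable φ := φd.continuous.integrable_of_hasCompactSupport φc
    have hpt : ∀ x, |f x| - |f x - g x| - ε * |f x| ≤ f x * φ x := by
      intro x
      have h1 := (φε x).le
      rw [Real.dist_eq] at h1
      have h5 := abs_le.1 h1
      have h6 := le_abs_self (1 - g x)
      have h7 := neg_abs_le (-1 - g x)
      have h8 := abs_nonneg (1 - g x)
      have h9 := abs_nonneg (-1 - g x)
      rcases hf1 x with h0 | h0 | h0
      · simp [h0]
      · have : 1 - |1 - g x| ≤ g' x := le_max_of_le_right (le_min (by linarith) (by linarith))
        rw [h0]; simp only [abs_one]; linarith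
      · have : g' x ≤ -1 + |-1 - g x| :=
          max_le (by linarith) ((min_le_right _ _).trans (by linarith))
        rw [h0]; simp only [abs_neg, abs_one]; linarith
    have hchi : ∀ (ψ : Euc n → ℝ), (fun x => chi E x * ψ x) = E.indicator ψ := by
      intro ψ; ext x; by_cases hx : x ∈ E <;> simp [chi, hx]
    have φi' : Integrable (fun x => φ (x + h)) := φi.comp_add_right h
    have i1 : Integrable (fun x => chi E x * φ x) := by
      rw [hchi]; exact φi.indicator hEm
    have i2 : Integrable (fun x => chi E x * φ (x + h)) := by
      rw [hchi (fun x => φ (x + h))]; exact φi'.indicator hEm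
    have i3 : Integrable (fun x => chi E (x - h) * φ x) := by
      simpa using i2.comp_sub_right h
    have hfφ : ∫ x, f x * φ x = (∫ x in E, φ (x + h)) - ∫ x in E, φ x := by
      have e1 : ∫ x, chi E (x - h) * φ x = ∫ x, chi E x * φ (x + h) := by
        rw [← integral_sub_right_eq_self (fun x => chi E x * φ (x + h)) h]
        simp
      simp only [hf, sub_mul]
      rw [integral_sub i3 i1, e1, hchi φ, hchi (fun x => φ (x + h)), integral_indicator hEm,
        integral_indicator hEm]
    have i4 : Integrable (fun x => f x * φ x) := by
      simp only [hf, sub_mul]; exact i3.sub i1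
    have i5 : Integrable (fun x => |f x|) := hfi.abs
    have i6 : Integrable (fun x => |f x - g x|) := (hfi.sub gi).abs
    have h10 := integral_mono ((i5.sub i6).sub (i5.const_mul ε)) i4 hpt
    have h11 : ∫ x, ((fun x => |f x|) - (fun x => |f x - g x|) - fun x => ε * |f x|) x
        = (∫ x, |f x|) - (∫ x, |f x - g x|) - ε * ∫ x, |f x| := by
      rw [integral_sub' (i5.sub i6) (i5.const_mul ε), integral_sub' i5 i6, integral_const_mul]
    rw [h11, hfφ] at h10
    simp only [Real.norm_eq_abs] at gε
    linarith
  have lim1 : Tendsto (fun ε : ℝ => (1 - ε) * (∫ x, |f x|) - ε) (nhdsWithin 0 (Ioi 0))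
      (nhds ((1 - 0) * (∫ x, |f x|) - 0)) :=
    (Continuous.tendsto (by fun_prop) 0).mono_left nhdsWithin_le_nhds
  have lim2 : Tendsto (fun ε : ℝ => (1 + ε) * ‖h‖ * perim E) (nhdsWithin 0 (Ioi 0))
      (nhds ((1 + 0) * ‖h‖ * perim E)) :=
    (Continuous.tendsto (by fun_prop) 0).mono_left nhdsWithin_le_nhds
  have := le_of_tendsto_of_tendsto lim1 lim2 (by
    filter_upwards [self_mem_nhdsWithin] with ε hε using key ε hε)
  simpa using this

lemma int_abs_le' {n : ℕ} {E : Set (Euc n)} (hEm : MeasurableSet E)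
    (hV : volume E ≠ ∞) (h : Euc n) :
    ∫ x, |chi E (x - h) - chi E x| ≤ 2 * (volume E).toReal := by
  have hi : Integrable (chi E) := (integrable_indicator_iff hEm).2
    (integrableOn_const hV)
  have hi' : Integrable (fun x => chi E (x - h)) := hi.comp_sub_right h
  have e : ∫ x, chi E x = (volume E).toReal := by
    simp [chi, integral_indicator_one hEm, Measure.real]
  have e' : ∫ x, chi E (x - h) = (volume E).toReal := by
    rw [integral_sub_right_eq_self (chi E) h, e]
  have h0 : ∀ x, 0 ≤ chi E x := fun x => indicator_nonneg (by simp) x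
  calc ∫ x, |chi E (x - h) - chi E x| ≤ ∫ x, (chi E (x - h) + chi E x) := by
        refine integral_mono (hi'.sub hi).abs (hi'.add hi) fun x => ?_
        have := h0 x
        have := h0 (x - h)
        exact abs_le.2 ⟨by linarith, by linarith⟩
    _ = _ := by rw [integral_add hi' hi, e, e']; ring

lemma one_dim {s : ℝ} (hs : s ∈ Set.Ioo (0 : ℝ) 1) {a b : ℝ} (ha : 0 ≤ a) (hb : 0 ≤ b) :
    IntegrableOn (fun y : ℝ => min (y * a) b * y ^ (-1 - s)) (Ioi 0) ∧
    ∫ y in Ioi (0 : ℝ), min (y * a) b * y ^ (-1 - s) ≤ a ^ s * b ^ (1 - s) / (s * (1 - s)) := by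
  obtain ⟨s0, s1⟩ := hs
  have hs1 : 0 < 1 - s := by linarith
  rcases ha.eq_or_lt with rfl | ha
  · simp [hb, Real.zero_rpow s0.ne']
  rcases hb.eq_or_lt with rfl | hb
  · have : EqOn (fun y : ℝ => min (y * a) 0 * y ^ (-1 - s)) 0 (Ioi 0) := by
      intro y hy
      have : 0 ≤ y * a := (mul_pos hy ha).le
      simp [this]
    refine ⟨integrableOn_zero.congr_fun this.symm measurableSet_Ioi, ?_⟩
    rw [setIntegral_congr_fun measurableSet_Ioi this]
    simp [Real.zero_rpow hs1.ne']
  have hr : 0 < b / a := div_pos hb ha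
  set r := b / a with hrdef
  have hmeas : Measurable (fun y : ℝ => min (y * a) b * y ^ (-1 - s)) := by fun_prop
  have j1 : IntegrableOn (fun y : ℝ => a * y ^ (-s)) (Ioc 0 r) :=
    ((intervalIntegral.intervalIntegrable_rpow' (by linarith)).const_mul a).1
  have j2 : IntegrableOn (fun y : ℝ => b * y ^ (-1 - s)) (Ioi r) :=
    (integrableOn_Ioi_rpow_of_lt (by linarith) hr).const_mul b
  have l1 : ∀ y ∈ Ioc 0 r, min (y * a) b * y ^ (-1 - s) ≤ a * y ^ (-s) := by
    intro y hy
    have h1 : y ^ (-s) = y * y ^ (-1 - s) := by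
      rw [← Real.rpow_one_add' hy.1.le (by linarith)]; ring_nf
    rw [h1, ← mul_assoc, mul_comm a y]
    exact mul_le_mul_of_nonneg_right (min_le_left _ _) (Real.rpow_nonneg hy.1.le _)
  have l2 : ∀ y ∈ Ioi r, min (y * a) b * y ^ (-1 - s) ≤ b * y ^ (-1 - s) := by
    intro y hy
    exact mul_le_mul_of_nonneg_right (min_le_right _ _) (Real.rpow_nonneg (hr.trans hy).le _)
  have nn : ∀ y : ℝ, 0 < y → 0 ≤ min (y * a) b * y ^ (-1 - s) := fun y hy =>
    mul_nonneg (le_min (mul_pos hy ha).le hb.le) (Real.rpow_nonneg hy.le _)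
  have k1 : IntegrableOn (fun y : ℝ => min (y * a) b * y ^ (-1 - s)) (Ioc 0 r) := by
    refine Integrable.mono' j1 hmeas.aestronglyMeasurable ?_
    filter_upwards [ae_restrict_mem measurableSet_Ioc] with y hy
    rw [Real.norm_of_nonneg (nn y hy.1)]; exact l1 y hy
  have k2 : IntegrableOn (fun y : ℝ => min (y * a) b * y ^ (-1 - s)) (Ioi r) := by
    refine Integrable.mono' j2 hmeas.aestronglyMeasurable ?_
    filter_upwards [ae_restrict_mem measurableSet_Ioi] with y hy
    rw [Real.norm_of_nonneg (nn y (hr.trans hy))]; exact l2 y hy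
  have hU : Ioc 0 r ∪ Ioi r = Ioi 0 := Ioc_union_Ioi_eq_Ioi hr.le
  refine ⟨hU ▸ k1.union k2, ?_⟩
  rw [← hU, setIntegral_union (Ioc_disjoint_Ioi le_rfl) measurableSet_Ioi k1 k2]
  have m1 := setIntegral_mono_on k1 j1 measurableSet_Ioc l1
  have m2 := setIntegral_mono_on k2 j2 measurableSet_Ioi l2
  rw [integral_const_mul, ← intervalIntegral.integral_of_le (f := fun y : ℝ => y ^ (-s)) hr.le,
    integral_rpow (Or.inl (by linarith)), Real.zero_rpow (by linarith)] at m1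
  rw [integral_const_mul b, integral_Ioi_rpow_of_lt (by linarith) hr] at m2
  have e1 : a * r ^ (-s + 1) = a ^ s * b ^ (1 - s) := by
    have : -s + 1 = 1 - s := by ring
    rw [this, hrdef, Real.div_rpow hb.le ha.le, Real.rpow_sub ha, Real.rpow_one]
    have := Real.rpow_pos_of_pos ha s
    field_simp
  have e2 : b * r ^ (-s) = a ^ s * b ^ (1 - s) := by
    rw [hrdef, Real.rpow_neg hr.le, Real.div_rpow hb.le ha.le, Real.rpow_sub hb, Real.rpow_one]
    have := Real.rpow_pos_of_pos ha s
    have := Real.rpow_pos_of_pos hb s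
    field_simp
  have e3 : -1 - s + 1 = -s := by ring
  have t1 : a * ((r ^ (-s + 1) - 0) / (-s + 1)) = a ^ s * b ^ (1 - s) / (1 - s) := by
    rw [← e1]; ring
  have t2 : b * (-r ^ (-1 - s + 1) / (-1 - s + 1)) = a ^ s * b ^ (1 - s) / s := by
    rw [e3, ← e2]; field_simp
  rw [t1] at m1
  rw [t2] at m2
  refine (add_le_add m1 m2).trans (le_of_eq ?_)
  field_simp
  ring

lemma radial {n : ℕ} (hn : 2 ≤ n) {s : ℝ} (hs : s ∈ Set.Ioo (0 : ℝ) 1) {a b : ℝ}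
    (ha : 0 ≤ a) (hb : 0 ≤ b) :
    Integrable (fun x : Euc n => min (‖x‖ * a) b * ‖x‖ ^ (-((n : ℝ) + s))) ∧
    ∫ x : Euc n, min (‖x‖ * a) b * ‖x‖ ^ (-((n : ℝ) + s)) ≤
      n * ballVol n * (a ^ s * b ^ (1 - s) / (s * (1 - s))) := by
  have : Nontrivial (Fin n) := Fin.nontrivial_iff_two_le.2 hn
  have : Nonempty (Fin n) := inferInstance
  have : Nontrivial (Euc n) := inferInstance
  have e : EqOn (fun y : ℝ => y ^ (Module.finrank ℝ (Euc n) - 1) •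
      (min (y * a) b * y ^ (-((n : ℝ) + s))))
      (fun y : ℝ => min (y * a) b * y ^ (-1 - s)) (Ioi 0) := by
    intro y hy
    have hy' : (0 : ℝ) < y := hy
    simp only [finrank_euclideanSpace, Fintype.card_fin, smul_eq_mul]
    rw [mul_left_comm, ← Real.rpow_natCast, ← Real.rpow_add hy', Nat.cast_sub (by omega)]
    congr 2
    push_cast; ring
  obtain ⟨h1, h2⟩ := one_dim hs ha hb
  constructor
  · rw [integrable_fun_norm_addHaar (volume : Measure (Euc n))
      (f := fun y => min (y * a) b * y ^ (-((n : ℝ) + s)))]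
    exact h1.congr_fun e.symm measurableSet_Ioi
  · rw [integral_fun_norm_addHaar (volume : Measure (Euc n))
      (fun y => min (y * a) b * y ^ (-((n : ℝ) + s))), setIntegral_congr_fun measurableSet_Ioi e]
    simp only [finrank_euclideanSpace, Fintype.card_fin, smul_eq_mul, nsmul_eq_mul]
    rw [← mul_assoc]
    exact mul_le_mul_of_nonneg_left h2 (by positivity)

/-- interpolation inequality `P_K(E) ≤ P_s(E) ≤ (2^{1-s} n ω_n /(s(1-s))) P(E)^s |E|^{1-s}`. -/
theorem stmt_0 (n : ℕ) (hn : 2 ≤ n) (s : ℝ) (hs : s ∈ Set.Ioo (0 : ℝ) 1)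
    (K : Euc n → ℝ) (hKmeas : Measurable K) (hK0 : ∀ x, 0 ≤ K x)
    (hKle : ∀ x : Euc n, x ≠ 0 → K x ≤ ‖x‖ ^ (-((n : ℝ) + s)))
    (E : Set (Euc n)) (hEmeas : MeasurableSet E) (hEper : HasFinitePerim E)
    (hEvol : volume E ≠ ∞) :
    PK K E ≤ Ps n s E ∧
      Ps n s E ≤ 2 ^ (1 - s) * n * ballVol n / (s * (1 - s)) *
        perim E ^ s * (volume E).toReal ^ (1 - s) := by
  obtain ⟨hs0, hs1⟩ := hs
  have hs1' : 0 < 1 - s := by linarith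
  set P := perim E with hPdef
  set V := (volume E).toReal with hVdef
  have hP : 0 ≤ P := perim_nonneg hEper
  have hV : 0 ≤ V := ENNReal.toReal_nonneg
  obtain ⟨rad1, rad2⟩ := radial hn ⟨hs0, hs1⟩ hP (mul_nonneg zero_le_two hV)
  set H : Euc n × Euc n → ℝ :=
    fun p => |chi E (p.1 - p.2) - chi E p.1| * ‖p.2‖ ^ (-((n : ℝ) + s)) with hH
  have hchim : Measurable (chi E) := measurable_one.indicator hEmeas
  have hHm : Measurable H := by
    have : Measurable (fun p : Euc n × Euc n => chi E (p.1 - p.2)) :=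
      hchim.comp (measurable_fst.sub measurable_snd)
    have : Measurable (fun p : Euc n × Euc n => chi E p.1) := hchim.comp measurable_fst
    have : Measurable (fun p : Euc n × Euc n => ‖p.2‖ ^ (-((n : ℝ) + s))) :=
      (measurable_snd.norm).pow_const _
    simp only [hH]
    fun_prop
  have hH0 : ∀ p, 0 ≤ H p := fun p => mul_nonneg (abs_nonneg _) (Real.rpow_nonneg (norm_nonneg _) _)
  have hi : Integrable (chi E) := (integrable_indicator_iff hEmeas).2 (integrableOn_const hEvol)
  have hHx : ∀ h : Euc n, ∫ x, H (x, h) ≤ min (‖h‖ * P) (2 * V) * ‖h‖ ^ (-((n : ℝ) + s)) := by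
    intro h
    simp only [hH]
    rw [integral_mul_const]
    exact mul_le_mul_of_nonneg_right
      (le_min (int_abs_le hEmeas hEper hEvol h) (int_abs_le' hEmeas hEvol h))
      (Real.rpow_nonneg (norm_nonneg _) _)
  have hHint : Integrable H (volume.prod volume) := by
    rw [integrable_prod_iff' hHm.aestronglyMeasurable]
    constructor
    · refine Eventually.of_forall fun h => ?_
      exact (((hi.comp_sub_right h).sub hi).abs).mul_const (‖h‖ ^ (-((n : ℝ) + s)))
    · refine Integrable.mono' rad1 ?_ (Eventually.of_forall fun h => ?_)
      · exact (hHm.norm.stronglyMeasurable.integral_prod_left' (μ := volume)).aestronglyMeasurable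
      · rw [Real.norm_of_nonneg (integral_nonneg fun x => norm_nonneg _)]
        simp only [Real.norm_of_nonneg (hH0 _)]
        exact hHx h
  have hF : ∀ x y : Euc n, |chi E x - chi E y| / ‖x - y‖ ^ ((n : ℝ) + s) = H (x, x - y) := by
    intro x y
    simp only [hH, sub_sub_cancel]
    rw [abs_sub_comm, Real.rpow_neg (norm_nonneg _), div_eq_mul_inv]
  have hPs : Ps n s E = ∫ x, ∫ h, H (x, h) := by
    unfold Ps
    refine integral_congr_ae (Eventually.of_forall fun x => ?_)
    simp only [hF]
    exact integral_sub_left_eq_self (fun h => H (x, h)) volume x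
  constructor
  · rw [hPs]
    unfold PK
    refine integral_mono_of_nonneg ?_ hHint.integral_prod_left ?_
    · exact Eventually.of_forall fun x => integral_nonneg fun y =>
        mul_nonneg (hK0 _) (abs_nonneg _)
    · filter_upwards [hHint.prod_right_ae] with x hx
      rw [← integral_sub_left_eq_self (fun h => H (x, h)) volume x]
      refine integral_mono_of_nonneg ?_ (hx.comp_sub_left x) ?_
      · exact Eventually.of_forall fun y => mul_nonneg (hK0 _) (abs_nonneg _)
      · refine Eventually.of_forall fun y => ?_
        simp only [hH, sub_sub_cancel]
        rcases eq_or_ne x y with rfl | hxy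
        · simp
        · rw [abs_sub_comm, mul_comm]
          exact mul_le_mul_of_nonneg_left (hKle _ (sub_ne_zero.2 hxy)) (abs_nonneg _)
  · rw [hPs, integral_integral_swap (f := fun x h => H (x, h)) hHint]
    calc ∫ h, ∫ x, H (x, h)
        ≤ ∫ h : Euc n, min (‖h‖ * P) (2 * V) * ‖h‖ ^ (-((n : ℝ) + s)) :=
          integral_mono hHint.integral_prod_right rad1 hHx
      _ ≤ _ := rad2
      _ = _ := by
        rw [Real.mul_rpow zero_le_two hV]
        ring
end
end

section
/- Let n ≥ 2, s ∈ (0,1), and let K : ℝⁿ → [0,∞) be measurable with 0 ≤ K(x) ≤ |x|^{−(n+s)} for all x ≠ 0. Suppose F_k and E are sets of finite perimeter and finite measure such that χ_{F_k} converges to χ_E strongly in L¹(ℝⁿ) and sup_k P(F_k) < ∞. Then lim_{k→∞} P_K(F_k) = P_K(E). -/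
open MeasureTheory Metric Set Filter
open scoped ENNReal Pointwise symmDiff Classical

noncomputable section

def wF {n : ℕ} (F : Set (Euc n)) (h : Euc n) : ℝ := ∫ x, |chi F x - chi F (x - h)|

lemma sum_single_smul {n : ℕ} (v : Euc n) :
    ∑ i : Fin n, v i • (EuclideanSpace.single i (1 : ℝ) : Euc n) = v := by
  have := (EuclideanSpace.basisFun (Fin n) ℝ).sum_repr v
  simpa using this

lemma perim_test {n : ℕ} {F : Set (Euc n)} (hF : HasFinitePerim F) (φ : Euc n → ℝ)
    (h1 : ContDiff ℝ 1 φ) (h2 : HasCompactSupport φ) (h3 : ∀ x, |φ x| ≤ 1) (v : Euc n) :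
    ∫ x in F, fderiv ℝ φ x v ≤ ‖v‖ * perim F := by
  by_cases hv : v = 0
  · simp [hv]
  have hv' : 0 < ‖v‖ := norm_pos_iff.mpr hv
  have hmem : (∫ x in F, ‖v‖⁻¹ * fderiv ℝ φ x v) ∈ perimVals F := by
    refine ⟨fun x => φ x • (‖v‖⁻¹ • v), h1.smul contDiff_const, h2.smul_right, ?_, ?_⟩
    · intro x
      rw [norm_smul, norm_smul, norm_inv, norm_norm, inv_mul_cancel₀ hv'.ne', mul_one]
      exact h3 x
    · congr 1
      ext x
      have hd : DifferentiableAt ℝ φ x := (h1.differentiable (by norm_num)) x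
      simp only [divg]
      rw [(hd.hasFDerivAt.smul_const (‖v‖⁻¹ • v)).fderiv]
      simp only [ContinuousLinearMap.smulRight_apply, PiLp.smul_apply, smul_eq_mul]
      conv_lhs => rw [← sum_single_smul v, map_sum, sum_single_smul v]
      simp only [map_smul, smul_eq_mul, Finset.mul_sum]
      exact Finset.sum_congr rfl fun i _ => by ring
  have := le_csSup hF hmem
  rw [integral_const_mul] at this
  change _ ≤ perim F at this
  rwa [inv_mul_le_iff₀ hv'] at this

lemma comp_add_supp {n : ℕ} {φ : Euc n → ℝ} (h2 : HasCompactSupport φ) (a : Euc n) :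
    HasCompactSupport (fun x => φ (x + a)) :=
  h2.comp_homeomorph (Homeomorph.addRight a)

lemma perim_shift {n : ℕ} {F : Set (Euc n)} (hF : HasFinitePerim F) (hvol : volume F ≠ ∞)
    (φ : Euc n → ℝ)
    (h1 : ContDiff ℝ 1 φ) (h2 : HasCompactSupport φ) (h3 : ∀ x, |φ x| ≤ 1) (h : Euc n) :
    (∫ x in F, φ (x + h)) - ∫ x in F, φ x ≤ ‖h‖ * perim F := by
  have hfin : IsFiniteMeasure (volume.restrict F) := ⟨by simpa using hvol.lt_top⟩
  have hc : Continuous (fderiv ℝ φ) := h1.continuous_fderiv (by norm_num)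
  obtain ⟨C, hC⟩ := hc.bounded_above_of_compact_support (h2.fderiv ℝ)
  have hφi : ∀ a : Euc n, Integrable (fun x => φ (x + a)) (volume.restrict F) := fun a =>
    ((h1.continuous.comp (continuous_add_const a)).integrable_of_hasCompactSupport
      (comp_add_supp h2 a)).integrableOn
  have key : ∀ t : ℝ, HasDerivAt (fun t : ℝ => ∫ x in F, φ (x + t • h))
      (∫ x in F, fderiv ℝ φ (x + t • h) h) t := by
    intro t
    refine (hasDerivAt_integral_of_dominated_loc_of_deriv_le (s := Set.univ)
      (F := fun (t : ℝ) x => φ (x + t • h)) (F' := fun (t : ℝ) x => fderiv ℝ φ (x + t • h) h)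
      (bound := fun _ => C * ‖h‖) Filter.univ_mem
      (Filter.Eventually.of_forall fun t => (hφi _).aestronglyMeasurable) (hφi _) ?_ ?_ ?_ ?_).2
    · exact ((hc.comp (continuous_add_const _)).clm_apply continuous_const).aestronglyMeasurable
    · exact Filter.Eventually.of_forall fun x t _ => (ContinuousLinearMap.le_opNorm _ _).trans
        (mul_le_mul_of_nonneg_right (hC _) (norm_nonneg _))
    · exact integrable_const _
    · refine Filter.Eventually.of_forall fun x t _ => ?_
      have hd : HasFDerivAt φ (fderiv ℝ φ (x + t • h)) (x + t • h) :=
        ((h1.differentiable (by norm_num)) _).hasFDerivAt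
      have hl : HasDerivAt (fun t : ℝ => x + t • h) h t := by
        simpa using ((hasDerivAt_id t).smul_const h).const_add x
      exact hd.comp_hasDerivAt t hl
  have := image_sub_le_mul_sub_of_deriv_le (f := fun t : ℝ => ∫ x in F, φ (x + t • h))
    (fun t => (key t).differentiableAt) (C := ‖h‖ * perim F) (fun t => by
      rw [(key t).deriv]
      have := perim_test hF (fun x => φ (x + t • h)) (h1.comp (contDiff_id.add contDiff_const))
        (comp_add_supp h2 _) (fun x => h3 _) h
      simpa only [fderiv_comp_add_right] using this) (zero_le_one' ℝ)
  simpa using this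

lemma chi_int {n : ℕ} {F : Set (Euc n)} (hm : MeasurableSet F) (hvol : volume F ≠ ∞) :
    Integrable (chi F) := by
  unfold chi
  exact (integrable_indicator_iff hm).2 (integrableOn_const hvol)

lemma chi_meas {n : ℕ} {F : Set (Euc n)} (hm : MeasurableSet F) : Measurable (chi F) :=
  measurable_one.indicator hm

lemma chi_cases {n : ℕ} (F : Set (Euc n)) (x : Euc n) : chi F x = 0 ∨ chi F x = 1 := by
  unfold chi
  by_cases h : x ∈ F <;> simp [h]

lemma wF_int {n : ℕ} {F : Set (Euc n)} (hm : MeasurableSet F) (hvol : volume F ≠ ∞) (h : Euc n) :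
    Integrable (fun x => chi F x - chi F (x - h)) :=
  (chi_int hm hvol).sub ((chi_int hm hvol).comp_sub_right h)

lemma sin_approx (u t : ℝ) (hu : u = 0 ∨ u = 1 ∨ u = -1) :
    |u - Real.sin (Real.pi / 2 * t)| ≤ 2 * |u - t| := by
  have hs : u = Real.sin (Real.pi / 2 * u) := by
    rcases hu with rfl | rfl | rfl <;> simp
  conv_lhs => rw [hs]
  have := Real.abs_sin_sub_sin_le (Real.pi / 2 * u) (Real.pi / 2 * t)
  refine this.trans ?_
  rw [← mul_sub, abs_mul, abs_of_pos (by positivity)]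
  exact mul_le_mul_of_nonneg_right (by linarith [Real.pi_le_four]) (abs_nonneg _)

lemma wF_le_perim {n : ℕ} {F : Set (Euc n)} (hF : HasFinitePerim F) (hm : MeasurableSet F)
    (hvol : volume F ≠ ∞) (h : Euc n) : wF F h ≤ ‖h‖ * perim F := by
  refine le_of_forall_pos_le_add fun ε hε => ?_
  set u : Euc n → ℝ := fun x => chi F x - chi F (x - h) with hu
  have hui : Integrable u := wF_int hm hvol h
  have huc : ∀ x, u x = 0 ∨ u x = 1 ∨ u x = -1 := fun x => by
    rcases chi_cases F x with a | a <;> rcases chi_cases F (x - h) with b | b <;> simp [hu, a, b]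
  obtain ⟨g, hg1, hg2, hg3⟩ := MemLp.exist_eLpNorm_sub_le ENNReal.one_ne_top le_rfl
    (memLp_one_iff_integrable.2 hui) (half_pos hε)
  have hgi : Integrable g := hg2.continuous.integrable_of_hasCompactSupport hg1
  set φ : Euc n → ℝ := fun x => Real.sin (Real.pi / 2 * g x) with hφ
  have hφ1 : ContDiff ℝ 1 φ :=
    Real.contDiff_sin.comp (contDiff_const.mul (hg2.of_le (by exact_mod_cast le_top)))
  have hφ2 : HasCompactSupport φ := hg1.comp_left (g := fun t => Real.sin (Real.pi / 2 * t)) (by simp)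
  have hφ3 : ∀ x, |φ x| ≤ 1 := fun x => Real.abs_sin_le_one _
  have hφi : Integrable φ := hφ1.continuous.integrable_of_hasCompactSupport hφ2
  have hd : ∫ x, |u x - g x| ≤ ε / 2 := by
    have h1 := integral_norm_eq_lintegral_enorm (hui.sub hgi).aestronglyMeasurable
    rw [← eLpNorm_one_eq_lintegral_enorm] at h1
    have h2 := ENNReal.toReal_mono ENNReal.ofReal_ne_top hg3
    rw [ENNReal.toReal_ofReal (half_pos hε).le, ← h1] at h2
    simpa using h2
  have hd2 : ∫ x, |u x - φ x| ≤ ε := by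
    calc ∫ x, |u x - φ x| ≤ ∫ x, 2 * |u x - g x| :=
          integral_mono (hui.sub hφi).abs ((hui.sub hgi).abs.const_mul 2)
            (fun x => sin_approx _ _ (huc x))
      _ = 2 * ∫ x, |u x - g x| := integral_const_mul _ _
      _ ≤ ε := by linarith
  have hmul : ∀ ψ : Euc n → ℝ, (fun x => chi F x * ψ x) = F.indicator ψ := fun ψ => by
    ext x
    unfold chi
    by_cases hx : x ∈ F <;> simp [hx]
  have hi1 : Integrable (fun x => chi F x * φ x) := by
    rw [hmul]; exact hφi.indicator hm
  have hi2' : Integrable (fun x => chi F x * φ (x + h)) := by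
    rw [hmul (fun x => φ (x + h))]; exact (hφi.comp_add_right h).indicator hm
  have hi2 : Integrable (fun x => chi F (x - h) * φ x) := by
    have := hi2'.comp_sub_right h
    simpa using this
  have huφ : ∫ x, u x * φ x ≤ ‖h‖ * perim F := by
    have e1 : ∫ x, u x * φ x = (∫ x in F, φ x) - ∫ x in F, φ (x + h) := by
      simp only [hu, sub_mul]
      rw [integral_sub hi1 hi2, hmul, integral_indicator hm]
      congr 1
      have := integral_sub_right_eq_self (μ := (volume : Measure (Euc n)))
        (fun x => chi F x * φ (x + h)) h
      simp only [sub_add_cancel] at this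
      rw [this, hmul (fun x => φ (x + h)), integral_indicator hm]
    have := perim_shift hF hvol (fun x => - φ x) hφ1.neg hφ2.neg (by simpa using hφ3) h
    simp only [integral_neg] at this
    rw [e1]; linarith
  have hiu : Integrable (fun x => u x * φ x) := by
    have := hi1.sub hi2
    refine this.congr (Filter.Eventually.of_forall fun x => ?_)
    simp [hu, sub_mul]
  calc wF F h = ∫ x, |u x| := rfl
    _ ≤ ∫ x, (u x * φ x + |u x - φ x|) := by
        refine integral_mono hui.abs (hiu.add (hui.sub hφi).abs) fun x => ?_
        have := hφ3 x
        have h5 := neg_abs_le (u x - φ x)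
        have h6 := le_abs_self (u x - φ x)
        dsimp only
        rcases huc x with a | a | a <;> rw [a] at h5 h6 ⊢ <;> norm_num at h5 h6 ⊢ <;> linarith
    _ = (∫ x, u x * φ x) + ∫ x, |u x - φ x| := integral_add hiu (hui.sub hφi).abs
    _ ≤ _ := add_le_add huφ hd2

lemma wF_nonneg {n : ℕ} (F : Set (Euc n)) (h : Euc n) : 0 ≤ wF F h :=
  integral_nonneg fun _ => abs_nonneg _

lemma chi_nonneg {n : ℕ} (F : Set (Euc n)) (x : Euc n) : 0 ≤ chi F x := by
  rcases chi_cases F x with a | a <;> simp [a]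

lemma wF_le_vol {n : ℕ} {F : Set (Euc n)} (hm : MeasurableSet F)
    (hvol : volume F ≠ ∞) (h : Euc n) : wF F h ≤ 2 * ∫ x, chi F x := by
  have hc := chi_int hm hvol
  calc wF F h ≤ ∫ x, (chi F x + chi F (x - h)) := by
        refine integral_mono (wF_int hm hvol h).abs (hc.add (hc.comp_sub_right h)) fun x => ?_
        have := abs_sub (chi F x) (chi F (x - h))
        simpa [abs_of_nonneg (chi_nonneg F _)] using this
    _ = _ := by
        rw [integral_add hc (hc.comp_sub_right h), integral_sub_right_eq_self (chi F) h]; ring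

lemma wF_diff {n : ℕ} {F E : Set (Euc n)} (hm : MeasurableSet F)
    (hvol : volume F ≠ ∞) (hm' : MeasurableSet E) (hvol' : volume E ≠ ∞) (h : Euc n) :
    |wF F h - wF E h| ≤ 2 * ∫ x, |chi F x - chi E x| := by
  have hc : Integrable (fun x => |chi F x - chi E x|) :=
    ((chi_int hm hvol).sub (chi_int hm' hvol')).abs
  have hi := (wF_int hm hvol h).abs
  have hi' := (wF_int hm' hvol' h).abs
  unfold wF
  rw [← integral_sub hi hi']
  calc _ ≤ ∫ x, |(|chi F x - chi F (x - h)| - |chi E x - chi E (x - h)|)| :=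
        abs_integral_le_integral_abs
    _ ≤ ∫ x, (|chi F x - chi E x| + |chi F (x - h) - chi E (x - h)|) := by
        refine integral_mono (hi.sub hi').abs (hc.add (hc.comp_sub_right h)) fun x => ?_
        refine (abs_abs_sub_abs_le _ _).trans ?_
        have := abs_sub (chi F x - chi E x) (chi F (x - h) - chi E (x - h))
        refine le_trans (le_of_eq ?_) this
        congr 1
        ring
    _ = _ := by
        rw [integral_add hc (hc.comp_sub_right h)]
        have := integral_sub_right_eq_self (μ := (volume : Measure (Euc n)))
          (fun x => |chi F x - chi E x|) h
        rw [this]; ring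

lemma dom_int {n : ℕ} (hn : 2 ≤ n) (s : ℝ) (hs : s ∈ Set.Ioo (0 : ℝ) 1) :
    Integrable (fun h : Euc n => ‖h‖ ^ (-((n : ℝ) + s)) * min ‖h‖ 1) := by
  have : Nontrivial (Euc n) := by
    have : Nonempty (Fin n) := ⟨⟨0, by omega⟩⟩
    infer_instance
  rw [integrable_fun_norm_addHaar (μ := (volume : Measure (Euc n)))
    (f := fun r : ℝ => r ^ (-((n : ℝ) + s)) * min r 1)]
  simp only [finrank_euclideanSpace, Fintype.card_fin, smul_eq_mul]
  have hpow : ∀ r : ℝ, 0 < r → r ^ (n - 1) * r ^ (-((n : ℝ) + s)) = r ^ (-1 - s) := by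
    intro r hr
    rw [← Real.rpow_natCast, ← Real.rpow_add hr, Nat.cast_sub (by omega)]
    congr 1; push_cast; ring
  rw [← Ioc_union_Ioi_eq_Ioi (zero_le_one' ℝ)]
  refine IntegrableOn.union ?_ ?_
  · have h1 : IntegrableOn (fun r : ℝ => r ^ (-s)) (Ioc 0 1) := by
      have := (intervalIntegral.intervalIntegrable_rpow' (a := 0) (b := 1) (r := -s)
        (by linarith [hs.2]))
      rwa [intervalIntegrable_iff_integrableOn_Ioc_of_le zero_le_one] at this
    refine h1.congr_fun (fun r hr => ?_) measurableSet_Ioc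
    dsimp only
    rw [min_eq_left hr.2, ← mul_assoc, hpow r hr.1]
    conv_rhs => rw [← Real.rpow_one r, ← Real.rpow_mul hr.1.le, one_mul, ← Real.rpow_add hr.1]
    congr 1; ring
  · refine (integrableOn_Ioi_rpow_of_lt (a := -1 - s) (by linarith [hs.1]) one_pos).congr_fun
      (fun r hr => ?_) measurableSet_Ioi
    have hr' : 1 < r := hr
    dsimp only
    rw [min_eq_right hr'.le, mul_one, hpow r (by linarith)]

lemma K_bound {n : ℕ} {s : ℝ} {K : Euc n → ℝ} (hK0 : ∀ x, 0 ≤ K x)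
    (hKle : ∀ x : Euc n, x ≠ 0 → K x ≤ ‖x‖ ^ (-((n : ℝ) + s)))
    {F : Set (Euc n)} (hF : HasFinitePerim F) (hm : MeasurableSet F)
    (hvol : volume F ≠ ∞) {C : ℝ} (hC1 : perim F ≤ C) (hC2 : 2 * ∫ x, chi F x ≤ C) (h : Euc n) :
    |K h * wF F h| ≤ C * (‖h‖ ^ (-((n : ℝ) + s)) * min ‖h‖ 1) := by
  have hC : 0 ≤ C := le_trans (mul_nonneg zero_le_two (integral_nonneg (chi_nonneg F))) hC2
  rw [abs_of_nonneg (mul_nonneg (hK0 h) (wF_nonneg F h))]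
  by_cases h0 : h = 0
  · have : wF F h = 0 := by simp [h0, wF]
    rw [this, mul_zero]; positivity
  have hw : wF F h ≤ C * min ‖h‖ 1 := by
    rw [mul_min_of_nonneg _ _ hC]
    refine le_min ?_ ?_
    · refine (wF_le_perim hF hm hvol h).trans ?_
      rw [mul_comm]
      exact mul_le_mul_of_nonneg_right hC1 (norm_nonneg _)
    · rw [mul_one]; exact (wF_le_vol hm hvol h).trans hC2
  calc K h * wF F h ≤ ‖h‖ ^ (-((n : ℝ) + s)) * (C * min ‖h‖ 1) :=
        mul_le_mul (hKle h h0) hw (wF_nonneg F h) (by positivity)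
    _ = _ := by ring

lemma G_meas {n : ℕ} {K : Euc n → ℝ} (hKmeas : Measurable K)
    {F : Set (Euc n)} (hm : MeasurableSet F) :
    Measurable (fun p : Euc n × Euc n => K p.2 * |chi F p.1 - chi F (p.1 - p.2)|) := by
  have h1 : Measurable (fun p : Euc n × Euc n => chi F p.1) := (chi_meas hm).comp measurable_fst
  have h2 : Measurable (fun p : Euc n × Euc n => chi F (p.1 - p.2)) :=
    (chi_meas hm).comp (measurable_fst.sub measurable_snd)
  exact (hKmeas.comp measurable_snd).mul (continuous_abs.measurable.comp (h1.sub h2))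

lemma KwF_meas {n : ℕ} {K : Euc n → ℝ} (hKmeas : Measurable K)
    {F : Set (Euc n)} (hm : MeasurableSet F) :
    AEStronglyMeasurable (fun h => K h * wF F h) volume := by
  have := (G_meas hKmeas hm).stronglyMeasurable.integral_prod_left'
    (μ := (volume : Measure (Euc n)))
  simp only [integral_const_mul] at this
  exact this.aestronglyMeasurable

lemma PK_eq {n : ℕ} (hn : 2 ≤ n) {s : ℝ} (hs : s ∈ Set.Ioo (0 : ℝ) 1) {K : Euc n → ℝ}
    (hKmeas : Measurable K) (hK0 : ∀ x, 0 ≤ K x)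
    (hKle : ∀ x : Euc n, x ≠ 0 → K x ≤ ‖x‖ ^ (-((n : ℝ) + s)))
    {F : Set (Euc n)} (hF : HasFinitePerim F) (hm : MeasurableSet F)
    (hvol : volume F ≠ ∞) : PK K F = ∫ h, K h * wF F h := by
  have hint : Integrable (Function.uncurry fun x h : Euc n => K h * |chi F x - chi F (x - h)|)
      (volume.prod volume) := by
    refine (integrable_prod_iff' (G_meas hKmeas hm).aestronglyMeasurable).2 ⟨?_, ?_⟩
    · exact Filter.Eventually.of_forall fun h => (wF_int hm hvol h).abs.const_mul (K h)
    · have hb := (dom_int hn s hs).const_mul (max (perim F) (2 * ∫ x, chi F x))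
      refine (hb.mono' (KwF_meas hKmeas hm) (Filter.Eventually.of_forall fun h =>
        K_bound hK0 hKle hF hm hvol (le_max_left _ _) (le_max_right _ _) h)).congr
          (Filter.Eventually.of_forall fun h => ?_)
      simp only [norm_mul, Real.norm_eq_abs, abs_abs, abs_of_nonneg (hK0 _)]
      rw [integral_const_mul]; rfl
  calc PK K F = ∫ x, ∫ h, K h * |chi F x - chi F (x - h)| := by
        unfold PK
        congr 1
        ext x
        have := integral_sub_left_eq_self (fun h => K h * |chi F x - chi F (x - h)|)
          (volume : Measure (Euc n)) x
        simpa using this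
    _ = ∫ h, ∫ x, K h * |chi F x - chi F (x - h)| := integral_integral_swap hint
    _ = _ := by simp only [integral_const_mul]; rfl

/-- continuity of `P_K` along sequences converging strongly in `L¹` with
uniformly bounded perimeters. -/
theorem stmt_14 (n : ℕ) (hn : 2 ≤ n) (s : ℝ) (hs : s ∈ Set.Ioo (0 : ℝ) 1)
    (K : Euc n → ℝ) (hKmeas : Measurable K) (hK0 : ∀ x, 0 ≤ K x)
    (hKle : ∀ x : Euc n, x ≠ 0 → K x ≤ ‖x‖ ^ (-((n : ℝ) + s)))
    (F : ℕ → Set (Euc n)) (E : Set (Euc n))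
    (hFmeas : ∀ k, MeasurableSet (F k)) (hFper : ∀ k, HasFinitePerim (F k))
    (hFvol : ∀ k, volume (F k) ≠ ∞)
    (hEmeas : MeasurableSet E) (hEper : HasFinitePerim E) (hEvol : volume E ≠ ∞)
    (hL1 : Filter.Tendsto (fun k => ∫ x, |chi (F k) x - chi E x|) Filter.atTop (nhds 0))
    (hPbdd : ∃ Cp : ℝ, ∀ k, perim (F k) ≤ Cp) :
    Filter.Tendsto (fun k => PK K (F k)) Filter.atTop (nhds (PK K E)) := by
  obtain ⟨Cp, hCp⟩ := hPbdd
  have e1 : (fun k => PK K (F k)) = fun k => ∫ h, K h * wF (F k) h := funext fun k =>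
    PK_eq hn hs hKmeas hK0 hKle (hFper k) (hFmeas k) (hFvol k)
  rw [e1, PK_eq hn hs hKmeas hK0 hKle hEper hEmeas hEvol]
  have hcE := chi_int hEmeas hEvol
  refine tendsto_integral_filter_of_dominated_convergence
    (fun h => max Cp (2 * ((∫ x, chi E x) + 1)) * (‖h‖ ^ (-((n : ℝ) + s)) * min ‖h‖ 1))
    (Filter.Eventually.of_forall fun k => KwF_meas hKmeas (hFmeas k)) ?_
    ((dom_int hn s hs).const_mul _) ?_
  · filter_upwards [hL1.eventually (gt_mem_nhds one_pos)] with k hk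
    refine Filter.Eventually.of_forall fun h => ?_
    refine K_bound hK0 hKle (hFper k) (hFmeas k) (hFvol k) ((hCp k).trans (le_max_left _ _)) ?_ h
    refine le_trans ?_ (le_max_right _ _)
    have hcF := chi_int (hFmeas k) (hFvol k)
    have : ∫ x, chi (F k) x ≤ ∫ x, (chi E x + |chi (F k) x - chi E x|) :=
      integral_mono hcF (hcE.add (hcF.sub hcE).abs) fun x => by
        have := le_abs_self (chi (F k) x - chi E x)
        dsimp only
        linarith
    have hd : Integrable (fun x => |chi (F k) x - chi E x|) := (hcF.sub hcE).abs
    rw [integral_add hcE hd] at this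
    linarith
  · refine Filter.Eventually.of_forall fun h => Filter.Tendsto.const_mul _ ?_
    rw [tendsto_iff_dist_tendsto_zero]
    have h2 := hL1.const_mul 2
    rw [mul_zero] at h2
    exact squeeze_zero (fun _ => dist_nonneg)
      (fun k => wF_diff (hFmeas k) (hFvol k) hEmeas hEvol h) h2
end
end

section
/- For every integer n ≥ 2 and every real s ∈ (0,1), one has (2^{s/n} − 1)/(2^{1/n} − 1) > s(n+s)/(n+1). -/
/-- for every integer `n ≥ 2` and `s ∈ (0,1)`,
`(2^{s/n} - 1)/(2^{1/n} - 1) > s(n+s)/(n+1)`. -/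
theorem stmt_18 (n : ℕ) (hn : 2 ≤ n) (s : ℝ) (hs : s ∈ Set.Ioo (0 : ℝ) 1) :
    s * ((n : ℝ) + s) / ((n : ℝ) + 1) <
      ((2 : ℝ) ^ (s / (n : ℝ)) - 1) / ((2 : ℝ) ^ ((1 : ℝ) / (n : ℝ)) - 1) := by
  obtain ⟨hs0, hs1⟩ := hs
  have hN : (2 : ℝ) ≤ n := by exact_mod_cast hn
  generalize (n : ℝ) = N at hN
  have hN0 : N ≠ 0 := by linarith
  obtain ⟨L, hL⟩ : ∃ L, L = Real.log 2 / N := ⟨_, rfl⟩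
  have hNL : N * L = Real.log 2 := by rw [hL]; field_simp
  have hlog := Real.log_two_lt_d9
  have hlog0 := Real.log_two_gt_d9
  have hL0 : 0 < L := by rw [hL]; apply div_pos <;> linarith
  have e1 : (2 : ℝ) ^ (s / N) = Real.exp (L * s) := by
    rw [Real.rpow_def_of_pos (by norm_num), hL]; congr 1; ring
  have e2 : (2 : ℝ) ^ (1 / N) = Real.exp L := by
    rw [Real.rpow_def_of_pos (by norm_num), hL]; congr 1; ring
  rw [e1, e2]
  have hE : L + 1 ≤ Real.exp L := Real.add_one_le_exp L
  obtain ⟨E, hEE⟩ : ∃ E, E = Real.exp L := ⟨_, rfl⟩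
  rw [← hEE] at hE ⊢
  have hL1 : L ≤ 0.35 := by nlinarith
  have key : L ^ 2 * E * (N + 1) < 2 * (E - 1) := by
    have h1 : L * E ≤ (E - 1) * (1 + L) := by nlinarith
    have h2 : L * (N + 1) < 1.05 := by nlinarith
    have h3 : (1 + L) * (L * (N + 1)) < 2 := by nlinarith
    have h4 : 0 < L * (N + 1) := by nlinarith
    have h5 : L * E * (L * (N + 1)) ≤ (E - 1) * (1 + L) * (L * (N + 1)) :=
      mul_le_mul_of_nonneg_right h1 h4.le
    have h6 : (E - 1) * ((1 + L) * (L * (N + 1))) < (E - 1) * 2 :=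
      mul_lt_mul_of_pos_left h3 (by linarith)
    nlinarith
  let F : ℝ → ℝ := fun t => (N + 1) * (Real.exp (L * t) - 1) - (E - 1) * (t * (N + t))
  have hexp : ∀ t, HasDerivAt (fun t : ℝ => Real.exp (L * t)) (Real.exp (L * t) * L) t := by
    intro t
    simpa using ((hasDerivAt_id t).const_mul L).exp
  have d1 : ∀ t, HasDerivAt F ((N + 1) * (Real.exp (L * t) * L) - (E - 1) * (N + 2 * t)) t := by
    intro t
    have := (((hexp t).sub_const 1).const_mul (N + 1)).sub
      (((hasDerivAt_id t).mul ((hasDerivAt_id t).const_add N)).const_mul (E - 1))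
    refine this.congr_deriv ?_
    simp only [id]
    ring
  have d1' : deriv F = fun t => (N + 1) * (Real.exp (L * t) * L) - (E - 1) * (N + 2 * t) :=
    funext fun t => (d1 t).deriv
  have d2 : ∀ t, deriv (deriv F) t = (N + 1) * (Real.exp (L * t) * L * L) - (E - 1) * 2 := by
    intro t
    rw [d1']
    have := (((hexp t).mul_const L).const_mul (N + 1)).sub
      ((((hasDerivAt_id t).const_mul 2).const_add N).const_mul (E - 1))
    refine (this.congr_deriv ?_).deriv
    ring
  have hconc : StrictConcaveOn ℝ (Set.Icc 0 1) F := by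
    apply strictConcaveOn_of_deriv2_neg (convex_Icc 0 1)
    · exact fun t _ => (d1 t).continuousAt.continuousWithinAt
    · intro t ht
      rw [interior_Icc] at ht
      simp only [Function.iterate_succ, Function.iterate_zero, Function.comp, id]
      rw [d2]
      have : Real.exp (L * t) ≤ E := by
        rw [hEE]; apply Real.exp_le_exp.2; nlinarith [ht.2]
      have h7 : Real.exp (L * t) * (L ^ 2 * (N + 1)) ≤ E * (L ^ 2 * (N + 1)) :=
        mul_le_mul_of_nonneg_right this (by positivity)
      nlinarith
  have m0 : (0 : ℝ) ∈ Set.Icc (0 : ℝ) 1 := by simp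
  have m1 : (1 : ℝ) ∈ Set.Icc (0 : ℝ) 1 := by simp
  have hs1' : 0 < 1 - s := by linarith
  have h := hconc.2 m0 m1 zero_ne_one hs1' hs0 (by ring)
  simp only [F, smul_eq_mul, mul_zero, mul_one, zero_add, Real.exp_zero, ← hEE] at h
  rw [div_lt_div_iff₀ (by linarith) (by linarith)]
  nlinarith
end

section
/- For all integers n ≥ 2 and k ≥ 2 and every real s ∈ (0,1), one has ((k(k+n−2) − n + 1)/(n+1)) · ( (1 + (n+s)/2)/(1 + (n−2−s)/2) − 1 ) ≥ ( ∏_{j=1}^{k−1} (j + (n+s)/2) ) / ( ∏_{j=1}^{k−1} (j + (n−2−s)/2) ) − 1, with equality when k = 2. -/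
lemma aux_19 (n : ℕ) (hn : 2 ≤ n) (s : ℝ) (h0 : 0 < s) (h1 : s < 1) (m : ℕ) :
    (∏ j ∈ Finset.Icc 1 (m + 1), ((j : ℝ) + ((n : ℝ) + s) / 2)) /
        (∏ j ∈ Finset.Icc 1 (m + 1), ((j : ℝ) + ((n : ℝ) - 2 - s) / 2)) ≤
      1 + ((m : ℝ) + 1) * ((m : ℝ) + n + 1) / ((n : ℝ) + 1) * ((2 + 2 * s) / (n - s)) := by
  have hn' : (2 : ℝ) ≤ n := by exact_mod_cast hn
  have hd : (0 : ℝ) < n - s := by linarith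
  induction m with
  | zero =>
    have h2 : (1 : ℝ) + ((n : ℝ) - 2 - s) / 2 = (n - s) / 2 := by ring
    apply le_of_eq
    simp [h2]
    field_simp
    ring
  | succ m ih =>
    rw [Finset.prod_Icc_succ_top (show 1 ≤ m + 1 + 1 by omega), Finset.prod_Icc_succ_top (show 1 ≤ m + 1 + 1 by omega),
      mul_div_mul_comm]
    have hm : (0 : ℝ) ≤ m := Nat.cast_nonneg m
    push_cast
    have hp : (0 : ℝ) < (m : ℝ) + 1 + 1 + ((n : ℝ) - 2 - s) / 2 := by linarith
    have hq : (0 : ℝ) < 2 * m + n + 2 - s := by linarith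
    have hq' := hq.ne'
    have hr : (0 : ℝ) ≤ ((m : ℝ) + 1 + 1 + ((n : ℝ) + s) / 2) /
        ((m : ℝ) + 1 + 1 + ((n : ℝ) - 2 - s) / 2) := by positivity
    refine (mul_le_mul_of_nonneg_right ih hr).trans ?_
    have e : ((m : ℝ) + 1 + 1 + ((n : ℝ) + s) / 2) /
        ((m : ℝ) + 1 + 1 + ((n : ℝ) - 2 - s) / 2) = 1 + (2 + 2 * s) / (2 * m + n + 2 - s) := by
      rw [div_eq_iff hp.ne']
      generalize hD : 2 * (m : ℝ) + n + 2 - s = D at hq hq' ⊢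
      field_simp
      rw [← hD]
      ring
    rw [e, ← sub_nonneg]
    have e2 : 1 + ((m : ℝ) + 1 + 1) * ((m : ℝ) + 1 + n + 1) / ((n : ℝ) + 1) * ((2 + 2 * s) / (n - s))
        - (1 + ((m : ℝ) + 1) * ((m : ℝ) + n + 1) / ((n : ℝ) + 1) * ((2 + 2 * s) / (n - s)))
          * (1 + (2 + 2 * s) / (2 * m + n + 2 - s))
        = (2 + 2 * s) * ((1 - s) * (2 * (m + 1) * (m + 1 + n + 1)))
          / ((n + 1) * (n - s) * (2 * m + n + 2 - s)) := by
      clear e hr hp ih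
      generalize hD : 2 * (m : ℝ) + n + 2 - s = D at hq hq' ⊢
      field_simp
      rw [← hD]
      ring
    rw [e2]
    have : 0 < 1 - s := by linarith
    positivity

/-- the eigenvalue-gap inequality
`((k(k+n-2)-n+1)/(n+1)) ((1+(n+s)/2)/(1+(n-2-s)/2) - 1) ≥ ∏(j+(n+s)/2)/∏(j+(n-2-s)/2) - 1`,
with equality when `k = 2`. -/
theorem stmt_19 (n k : ℕ) (hn : 2 ≤ n) (hk : 2 ≤ k) (s : ℝ) (hs : s ∈ Set.Ioo (0 : ℝ) 1) :
    (∏ j ∈ Finset.Icc 1 (k - 1), ((j : ℝ) + ((n : ℝ) + s) / 2)) /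
        (∏ j ∈ Finset.Icc 1 (k - 1), ((j : ℝ) + ((n : ℝ) - 2 - s) / 2)) - 1 ≤
      ((k : ℝ) * ((k : ℝ) + (n : ℝ) - 2) - (n : ℝ) + 1) / ((n : ℝ) + 1) *
        ((1 + ((n : ℝ) + s) / 2) / (1 + ((n : ℝ) - 2 - s) / 2) - 1) ∧
    (k = 2 →
      (∏ j ∈ Finset.Icc 1 (k - 1), ((j : ℝ) + ((n : ℝ) + s) / 2)) /
          (∏ j ∈ Finset.Icc 1 (k - 1), ((j : ℝ) + ((n : ℝ) - 2 - s) / 2)) - 1 =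
        ((k : ℝ) * ((k : ℝ) + (n : ℝ) - 2) - (n : ℝ) + 1) / ((n : ℝ) + 1) *
          ((1 + ((n : ℝ) + s) / 2) / (1 + ((n : ℝ) - 2 - s) / 2) - 1)) := by
  obtain ⟨h0, h1⟩ := hs
  have hn' : (2 : ℝ) ≤ n := by exact_mod_cast hn
  have hd : (0 : ℝ) < n - s := by linarith
  have h2 : (1 : ℝ) + ((n : ℝ) - 2 - s) / 2 = (n - s) / 2 := by ring
  constructor
  · obtain ⟨m, rfl⟩ := Nat.exists_eq_add_of_le' hk
    have h := aux_19 n hn s h0 h1 m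
    rw [show m + 2 - 1 = m + 1 by omega]
    have e : (1 + ((n : ℝ) + s) / 2) / (1 + ((n : ℝ) - 2 - s) / 2) - 1 = (2 + 2 * s) / (n - s) := by
      rw [h2]
      field_simp
      ring
    rw [e]
    have e3 : ((m + 2 : ℕ) : ℝ) * (((m + 2 : ℕ) : ℝ) + (n : ℝ) - 2) - (n : ℝ) + 1
        = ((m : ℝ) + 1) * ((m : ℝ) + n + 1) := by
      push_cast
      ring
    rw [e3]
    linarith
  · rintro rfl
    have e4 : (((2 : ℕ) : ℝ) * (((2 : ℕ) : ℝ) + (n : ℝ) - 2) - (n : ℝ) + 1) / ((n : ℝ) + 1) = 1 := by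
      rw [div_eq_one_iff_eq (by positivity)]
      push_cast
      ring
    rw [e4]
    simp
end
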